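/- If X is a Banach space with dim X ≥ 2, then the set of spear vectors of X is nowhere dense in the unit sphere S_X with the norm topology. -/

import Mathlib

open Metric

/-- A spear vector: `z ∈ S_X` with `‖z + 𝕋x‖ = 1 + ‖x‖` for every `x ∈ X`. -/
def IsSpear (𝕜 : Type*) {X : Type*} [RCLike 𝕜] [NormedAddCommGroup X]
    [NormedSpace 𝕜 X] (z : X) : Prop :=
  ‖z‖ = 1 ∧ ∀ x : X, sSup {r : ℝ | ∃ ω : 𝕜, ‖ω‖ = 1 ∧ r = ‖z + ω • x‖} = 1 + ‖x‖

lemma spear_func {𝕜 X : Type*} [RCLike 𝕜] [NormedAddCommGroup X] [NormedSpace 𝕜 X]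
    {z : X} (hz : IsSpear 𝕜 z) (x : X) :
    ∃ (ω : 𝕜) (f : X →L[𝕜] 𝕜), ‖ω‖ = 1 ∧ (∀ v, ‖f v‖ ≤ ‖v‖) ∧ f z = 1 ∧ f (ω • x) = (‖x‖ : 𝕜) := by
  obtain ⟨hz1, hz2⟩ := hz
  have hK : IsCompact (sphere (0 : 𝕜) 1) := isCompact_sphere 0 1
  have hne : (sphere (0 : 𝕜) 1).Nonempty := ⟨1, by simp⟩
  have hc : ContinuousOn (fun ω : 𝕜 => ‖z + ω • x‖) (sphere (0 : 𝕜) 1) := by fun_prop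
  obtain ⟨ω, hω, hs⟩ := hK.exists_sSup_image_eq hne hc
  have hω1 : ‖ω‖ = 1 := by simpa using hω
  have hset : {r : ℝ | ∃ ω : 𝕜, ‖ω‖ = 1 ∧ r = ‖z + ω • x‖}
      = (fun ω : 𝕜 => ‖z + ω • x‖) '' (sphere (0 : 𝕜) 1) := by
    ext r; simp [eq_comm]
  have hn : ‖z + ω • x‖ = 1 + ‖x‖ := by rw [← hz2 x, hset, hs]
  have hne0 : z + ω • x ≠ 0 := by
    rw [← norm_pos_iff, hn]; positivity
  obtain ⟨f, hf1, hf2⟩ := exists_dual_vector 𝕜 (z + ω • x) (norm_ne_zero_iff.2 hne0)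
  have hle : ∀ v, ‖f v‖ ≤ ‖v‖ := fun v => by
    simpa [hf1] using f.le_opNorm v
  have hre : RCLike.re (f z) + RCLike.re (f (ω • x)) = 1 + ‖x‖ := by
    rw [← map_add, ← map_add, hf2, hn, RCLike.ofReal_re]
  have h1 : RCLike.re (f z) ≤ 1 := (RCLike.re_le_norm _).trans ((hle z).trans hz1.le)
  have hxn : ‖ω • x‖ = ‖x‖ := by rw [norm_smul, hω1, one_mul]
  have h2 : RCLike.re (f (ω • x)) ≤ ‖x‖ :=
    (RCLike.re_le_norm _).trans ((hle _).trans hxn.le)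
  have h3 : RCLike.re (f z) = 1 := by linarith
  have hfz : f z = 1 := by
    have h4 : ‖f z‖ = RCLike.re (f z) :=
      le_antisymm (by rw [h3]; exact (hle z).trans hz1.le) (RCLike.re_le_norm _)
    have h5 := RCLike.norm_sq_eq_def (z := f z)
    rw [h4, h3] at h5
    have h6 : RCLike.im (f z) = 0 := by nlinarith
    apply RCLike.ext <;> simp [h3, h6]
  refine ⟨ω, f, hω1, hle, hfz, ?_⟩
  have : f z + f (ω • x) = ((1 + ‖x‖ : ℝ) : 𝕜) := by rw [← map_add, hf2, hn]
  rw [hfz] at this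
  push_cast at this
  exact add_left_cancel this

lemma spear_ext {𝕜 X : Type*} [RCLike 𝕜] [NormedAddCommGroup X] [NormedSpace 𝕜 X]
    {m : X} (hm : IsSpear 𝕜 m) (x : X) (h1 : ‖m + x‖ ≤ 1) (h2 : ‖m - x‖ ≤ 1) : x = 0 := by
  obtain ⟨ω, f, hω, hle, hfm, hfx⟩ := spear_func hm x
  have hn : ‖f x‖ = ‖x‖ := by
    have := congrArg norm hfx
    simpa [hω] using this
  have a1 : ‖1 + f x‖ ≤ 1 := by
    rw [← hfm, ← map_add]; exact (hle _).trans h1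
  have a2 : ‖1 - f x‖ ≤ 1 := by
    rw [← hfm, ← map_sub]; exact (hle _).trans h2
  have hp := parallelogram_law_with_norm 𝕜 (1 : 𝕜) (f x)
  rw [norm_one] at hp
  rw [← norm_eq_zero, ← hn]
  nlinarith [norm_nonneg (1 + f x), norm_nonneg (1 - f x), norm_nonneg (f x)]

lemma spear_closed {𝕜 X : Type*} [RCLike 𝕜] [NormedAddCommGroup X] [NormedSpace 𝕜 X] :
    IsClosed {z : sphere (0 : X) 1 | IsSpear 𝕜 (z : X)} := by
  have : {z : sphere (0 : X) 1 | IsSpear 𝕜 (z : X)} = ⋂ x : X,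
      {z : sphere (0 : X) 1 | sSup ((fun ω : 𝕜 => ‖(z : X) + ω • x‖) '' (sphere (0 : 𝕜) 1))
        = 1 + ‖x‖} := by
    ext z
    simp only [IsSpear, Set.mem_setOf_eq, Set.mem_iInter, norm_eq_of_mem_sphere, true_and]
    refine forall_congr' fun x => ?_
    have hset : {r : ℝ | ∃ ω : 𝕜, ‖ω‖ = 1 ∧ r = ‖(z : X) + ω • x‖}
      = (fun ω : 𝕜 => ‖(z : X) + ω • x‖) '' (sphere (0 : 𝕜) 1) := by
      ext r; simp [eq_comm]
    rw [hset]
  rw [this]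
  refine isClosed_iInter fun x => isClosed_eq ?_ continuous_const
  exact (isCompact_sphere (0 : 𝕜) 1).continuous_sSup
    (f := fun (z : sphere (0 : X) 1) (ω : 𝕜) => ‖(z : X) + ω • x‖) (by
      change Continuous fun p : sphere (0 : X) 1 × 𝕜 => ‖(p.1 : X) + p.2 • x‖
      fun_prop)

/-- if `dim X ≥ 2`, then the set of spear vectors is nowhere dense in the
unit sphere `S_X` with the norm topology. -/
theorem stmt5 {𝕜 X : Type*} [RCLike 𝕜] [NormedAddCommGroup X] [NormedSpace 𝕜 X]
    [CompleteSpace X] (hdim : 2 ≤ Module.rank 𝕜 X) :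
    IsNowhereDense {z : sphere (0 : X) 1 | IsSpear 𝕜 (z : X)} := by
  rw [IsNowhereDense, spear_closed.closure_eq, Set.eq_empty_iff_forall_notMem]
  intro z hz
  rw [mem_interior_iff_mem_nhds, Metric.mem_nhds_iff] at hz
  obtain ⟨ε, hε, hB⟩ := hz
  have hz1 : ‖(z : X)‖ = 1 := norm_eq_of_mem_sphere z
  have key : ∀ y : X, ‖y‖ = 1 → ‖y - z‖ < ε → IsSpear 𝕜 y := fun y hy hd => by
    have : (⟨y, by simpa using hy⟩ : sphere (0 : X) 1) ∈ ball z ε := by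
      rw [mem_ball, Subtype.dist_eq, dist_eq_norm]; exact hd
    exact hB this
  -- every unit vector near z is a multiple of z
  have hmul : ∀ y : X, ‖y‖ = 1 → ‖y - z‖ < ε → ∃ c : 𝕜, y = c • (z : X) := by
    intro y hy hd
    obtain ⟨ω, f, hω, hle, hfz, hfy⟩ := spear_func (key z hz1 (by simpa using hε)) y
    rw [hy] at hfy
    have hω0 : ω ≠ 0 := by rintro rfl; simp at hω
    have h1 : ‖1 - ω‖ ≤ ‖y - z‖ := by
      have e : 1 - ω = f (ω • (y - z)) := by
        rw [smul_sub, map_sub, hfy, map_smul, hfz]; simp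
      rw [e]
      refine (hle _).trans ?_
      rw [norm_smul, hω, one_mul]
    have hwn : ‖ω • y‖ = 1 := by rw [norm_smul, hω, hy, one_mul]
    have h2 : ‖ω • y - z‖ < 2 * ε := by
      have e : ω • y - (z : X) = (y - z) - (1 - ω) • y := by
        rw [sub_smul, one_smul]; abel
      rw [e]
      refine (norm_sub_le _ _).trans_lt ?_
      rw [norm_smul, hy]; linarith
    have h20 : (2 : 𝕜) ≠ 0 := two_ne_zero
    have hn2 : ‖(2⁻¹ : 𝕜)‖ = 2⁻¹ := by rw [norm_inv, RCLike.norm_two]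
    have hh : ∀ v : X, (2⁻¹ : 𝕜) • v + (2⁻¹ : 𝕜) • v = v := fun v => by
      rw [← add_smul, ← two_mul, mul_inv_cancel₀ h20, one_smul]
    have hm1 : ‖(2⁻¹ : 𝕜) • ((z : X) + ω • y)‖ = 1 := by
      apply le_antisymm
      · rw [norm_smul, hn2]
        have := norm_add_le (z : X) (ω • y)
        linarith
      · have := hle ((2⁻¹ : 𝕜) • ((z : X) + ω • y))
        rw [map_smul, map_add, hfz, hfy] at this
        have e : (2⁻¹ : 𝕜) • ((1 : 𝕜) + ((1 : ℝ) : 𝕜)) = 1 := by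
          rw [smul_eq_mul, RCLike.ofReal_one, one_add_one_eq_two, inv_mul_cancel₀ h20]
        rwa [e, norm_one] at this
    have hm2 : ‖(2⁻¹ : 𝕜) • ((z : X) + ω • y) - z‖ < ε := by
      have e : (2⁻¹ : 𝕜) • ((z : X) + ω • y) - z = (2⁻¹ : 𝕜) • (ω • y - z) := by
        nth_rewrite 2 [← hh z]
        rw [smul_add, smul_sub]; abel
      rw [e, norm_smul, hn2]; linarith
    have hx := spear_ext (key _ hm1 hm2) ((2⁻¹ : 𝕜) • (ω • y - z))
      (by
        have e : (2⁻¹ : 𝕜) • ((z : X) + ω • y) + (2⁻¹ : 𝕜) • (ω • y - z) = ω • y := by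
          nth_rewrite 3 [← hh (ω • y)]
          rw [smul_add, smul_sub]; abel
        rw [e, hwn])
      (by
        have e : (2⁻¹ : 𝕜) • ((z : X) + ω • y) - (2⁻¹ : 𝕜) • (ω • y - z) = z := by
          nth_rewrite 3 [← hh z]
          rw [smul_add, smul_sub]; abel
        rw [e, hz1])
    have hwz : ω • y = z := by
      rcases smul_eq_zero.1 hx with h | h
      · exact absurd h (inv_ne_zero h20)
      · exact sub_eq_zero.1 h
    exact ⟨ω⁻¹, by rw [← hwz, inv_smul_smul₀ hω0]⟩
  -- a vector outside the line of z
  obtain ⟨x, hx⟩ : ∃ x : X, ∀ c : 𝕜, x ≠ c • (z : X) := by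
    by_contra! hcon
    have : Module.rank 𝕜 X ≤ 1 := rank_le_one_iff.2 ⟨z, fun v => by
      obtain ⟨c, hc⟩ := hcon v; exact ⟨c, hc.symm⟩⟩
    have h21 := hdim.trans this
    norm_num at h21
  have hz0 : (z : X) ≠ 0 := by rw [← norm_pos_iff, hz1]; exact one_pos
  have hcont : ContinuousAt
      (fun t : 𝕜 => ((‖(z : X) + t • x‖⁻¹ : ℝ) : 𝕜) • ((z : X) + t • x) - z) 0 := by
    have h0 : ‖(z : X) + (0 : 𝕜) • x‖ ≠ 0 := by simp [hz0]
    have hn : ContinuousAt (fun t : 𝕜 => ‖(z : X) + t • x‖⁻¹) 0 :=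
      ContinuousAt.inv₀ (by fun_prop) h0
    have hn' : ContinuousAt (fun t : 𝕜 => ((‖(z : X) + t • x‖⁻¹ : ℝ) : 𝕜)) 0 :=
      RCLike.continuous_ofReal.continuousAt.comp hn
    exact (hn'.smul (by fun_prop)).sub continuousAt_const
  have hev : ∀ᶠ t : 𝕜 in nhds 0,
      ‖((‖(z : X) + t • x‖⁻¹ : ℝ) : 𝕜) • ((z : X) + t • x) - z‖ < ε := by
    refine hcont.norm.eventually_lt continuousAt_const ?_
    simpa [hz1] using hε
  obtain ⟨t, ht, ht0⟩ := ((hev.filter_mono nhdsWithin_le_nhds).and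
    (self_mem_nhdsWithin : ({0}ᶜ : Set 𝕜) ∈ nhdsWithin 0 {0}ᶜ)).exists
  have ht0 : t ≠ 0 := ht0
  have hnz : ∀ c : 𝕜, (z : X) + t • x ≠ c • (z : X) := fun c hc => by
    apply hx (t⁻¹ * (c - 1))
    rw [mul_smul, sub_smul, one_smul, ← hc, add_sub_cancel_left, inv_smul_smul₀ ht0]
  have hpos : ‖(z : X) + t • x‖ ≠ 0 := by
    rw [norm_ne_zero_iff]; simpa using hnz 0
  obtain ⟨c, hc⟩ := hmul _ (by
    rw [norm_smul, RCLike.norm_ofReal, abs_of_nonneg (by positivity), inv_mul_cancel₀ hpos]) ht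
  apply hnz ((‖(z : X) + t • x‖ : 𝕜) * c)
  rw [mul_smul, ← hc, smul_smul, ← RCLike.ofReal_mul, mul_inv_cancel₀ hpos, RCLike.ofReal_one,
    one_smul]
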